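/- arXiv:2601.08710 — 2 statements merged into one kernel-verified Lean document; each statement's English description precedes it below -/
import Mathlib

section
/- Let E be a non-trivial equational theory, Γ an E-unification problem, X₀ := Var(Γ), and X ⊆ V a set of variables such that X₀ ⊆ X and V \ X is infinite. If Γ has a minimal complete set of E-unifiers w.r.t. ≤_E^X, then it has a minimal complete set of E-unifiers w.r.t. ≤_E^{X₀} of the same cardinality, and conversely, if Γ has a minimal complete set of E-unifiers w.r.t. ≤_E^{X₀}, then it has one w.r.t. ≤_E^X of the same cardinality. -/
namespace UnifFW

/-- First-order terms over a signature `F` (an arity-indexed family of function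
symbols), with variables from the countably infinite set `V = ℕ`. -/
inductive Term (F : ℕ → Type) : Type
  | var : ℕ → Term F
  | app : (n : ℕ) → F n → (Fin n → Term F) → Term F

variable {F : ℕ → Type}

/-- The set of variables occurring in a term. -/
def Term.vars : Term F → Set ℕ
  | .var x => {x}
  | .app _ _ ts => ⋃ i, (ts i).vars

/-- Homomorphic extension of a map `V → T(Σ,V)` to terms. -/
def Term.subst (σ : ℕ → Term F) : Term F → Term F
  | .var x => σ x
  | .app n f ts => .app n f (fun i => (ts i).subst σ)

/-- The congruence `≈_E` induced by a set `E` of identities: the smallest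
equivalence relation containing all substitution instances of identities of `E`
and compatible with the term constructors. -/
inductive EqE (E : Set (Term F × Term F)) : Term F → Term F → Prop
  | ax {s t : Term F} (σ : ℕ → Term F) : (s, t) ∈ E → EqE E (s.subst σ) (t.subst σ)
  | refl (t : Term F) : EqE E t t
  | symm {s t : Term F} : EqE E s t → EqE E t s
  | trans {s t u : Term F} : EqE E s t → EqE E t u → EqE E s u
  | congr {n : ℕ} (f : F n) {ts us : Fin n → Term F} :
      (∀ i, EqE E (ts i) (us i)) → EqE E (.app n f ts) (.app n f us)

/-- A theory is non-trivial if distinct variables are not equated. -/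
def NonTrivial (E : Set (Term F × Term F)) : Prop :=
  ∀ x y : ℕ, x ≠ y → ¬ EqE E (.var x) (.var y)

/-- A theory is regular if both sides of each identity have the same variables. -/
def Regular (E : Set (Term F × Term F)) : Prop :=
  ∀ p ∈ E, (Prod.fst p).vars = (Prod.snd p).vars

/-- A substitution: a map `V → T(Σ,V)` with finite domain. -/
structure Subst (F : ℕ → Type) where
  toFun : ℕ → Term F
  finite_dom : {x : ℕ | toFun x ≠ Term.var x}.Finite

/-- The domain of a substitution. -/
def Subst.Dom (σ : Subst F) : Set ℕ := {x : ℕ | σ.toFun x ≠ Term.var x}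

/-- The variable range of a substitution: all variables occurring in the images
of domain variables. -/
def Subst.VRan (σ : Subst F) : Set ℕ := ⋃ x ∈ σ.Dom, (σ.toFun x).vars

/-- The instantiation preorder `σ ≤_E^X θ`: some substitution `λ` satisfies
`λ(σ(x)) ≈_E θ(x)` for all `x ∈ X`. -/
def InstLE (E : Set (Term F × Term F)) (X : Set ℕ) (σ θ : Subst F) : Prop :=
  ∃ lam : Subst F, ∀ x ∈ X, EqE E ((σ.toFun x).subst lam.toFun) (θ.toFun x)

/-- The equivalence `σ ∼_E^X θ` induced by the instantiation preorder. -/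
def InstEquiv (E : Set (Term F × Term F)) (X : Set ℕ) (σ θ : Subst F) : Prop :=
  InstLE E X σ θ ∧ InstLE E X θ σ

/-- The strict instantiation order `σ <_E^X θ`. -/
def InstLT (E : Set (Term F × Term F)) (X : Set ℕ) (σ θ : Subst F) : Prop :=
  InstLE E X σ θ ∧ ¬ InstLE E X θ σ

/-- The set of variables occurring in a unification problem. -/
def VarsP (Γ : Set (Term F × Term F)) : Set ℕ :=
  ⋃ p ∈ Γ, (Prod.fst p).vars ∪ (Prod.snd p).vars

/-- `σ` is an `E`-unifier of the unification problem `Γ`. -/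
def Unifier (E Γ : Set (Term F × Term F)) (σ : Subst F) : Prop :=
  ∀ p ∈ Γ, EqE E ((Prod.fst p).subst σ.toFun) ((Prod.snd p).subst σ.toFun)

/-- A unification problem is solvable if it has a unifier. -/
def Solvable (E Γ : Set (Term F × Term F)) : Prop := ∃ σ : Subst F, Unifier E Γ σ

/-- `S` is a complete set of `E`-unifiers of `Γ` w.r.t. `≤_E^X`. -/
def CompleteSet (E Γ : Set (Term F × Term F)) (X : Set ℕ) (S : Set (Subst F)) : Prop :=
  (∀ σ ∈ S, Unifier E Γ σ) ∧ ∀ θ : Subst F, Unifier E Γ θ → ∃ σ ∈ S, InstLE E X σ θ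

/-- `S` is a minimal complete set of `E`-unifiers of `Γ` w.r.t. `≤_E^X`:
complete, and no two distinct elements are comparable. -/
def MinimalComplete (E Γ : Set (Term F × Term F)) (X : Set ℕ) (S : Set (Subst F)) : Prop :=
  CompleteSet E Γ X S ∧ ∀ σ ∈ S, ∀ θ ∈ S, σ ≠ θ → ¬ InstLE E X σ θ

/-- `Γ` has unification type unitary w.r.t. `≤_E^X`. -/
def TypeUnitary (E Γ : Set (Term F × Term F)) (X : Set ℕ) : Prop :=
  ∃ σ : Subst F, MinimalComplete E Γ X {σ}

/-- `Γ` has unification type finitary w.r.t. `≤_E^X`. -/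
def TypeFinitary (E Γ : Set (Term F × Term F)) (X : Set ℕ) : Prop :=
  ∃ S : Set (Subst F), MinimalComplete E Γ X S ∧ S.Finite ∧ 1 < S.ncard

/-- `Γ` has unification type infinitary w.r.t. `≤_E^X`. -/
def TypeInfinitary (E Γ : Set (Term F × Term F)) (X : Set ℕ) : Prop :=
  ∃ S : Set (Subst F), MinimalComplete E Γ X S ∧ S.Infinite

/-- `Γ` has unification type zero w.r.t. `≤_E^X`. -/
def TypeZero (E Γ : Set (Term F × Term F)) (X : Set ℕ) : Prop :=
  ¬ ∃ S : Set (Subst F), MinimalComplete E Γ X S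

/-- `σ` is a `≤_E^X`-minimal `E`-unifier of `Γ`. -/
def MinUnifier (E Γ : Set (Term F × Term F)) (X : Set ℕ) (σ : Subst F) : Prop :=
  Unifier E Γ σ ∧ ∀ θ : Subst F, Unifier E Γ θ → InstLE E X θ σ → InstLE E X σ θ

/-- The set `C_E(Γ)` of unifiers all of whose range variables occur in the
images of at least two distinct variables. -/
def CSet (E Γ : Set (Term F × Term F)) : Set (Subst F) :=
  {σ : Subst F | Unifier E Γ σ ∧
    ∀ y ∈ σ.VRan, ∃ x x' : ℕ, x ≠ x' ∧ y ∈ (σ.toFun x).vars ∩ (σ.toFun x').vars}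

/-- `E` is Noetherian w.r.t. the unrestricted instantiation preorder: there is
no infinite strictly descending chain `σ₁ >_E^V σ₂ >_E^V ⋯`. -/
def Noetherian (E : Set (Term F × Term F)) : Prop :=
  ¬ ∃ f : ℕ → Subst F, ∀ n : ℕ, InstLT E Set.univ (f (n + 1)) (f n)


theorem Term.finite_vars (t : Term F) : t.vars.Finite := by
  induction t with
  | var x => exact Set.finite_singleton x
  | app n f ts ih => exact Set.finite_iUnion ih

theorem Term.subst_congr {g h : ℕ → Term F} {t : Term F} (H : ∀ x ∈ t.vars, g x = h x) :
    t.subst g = t.subst h := by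
  induction t with
  | var x => exact H x rfl
  | app n f ts ih =>
    simp only [Term.subst]
    congr 1
    funext i
    exact ih i fun x hx => H x (Set.mem_iUnion.2 ⟨i, hx⟩)

theorem Term.subst_var (t : Term F) : t.subst Term.var = t := by
  induction t with
  | var x => rfl
  | app n f ts ih => simp only [Term.subst, ih]

theorem Term.subst_subst (g h : ℕ → Term F) (t : Term F) :
    (t.subst g).subst h = t.subst fun x => (g x).subst h := by
  induction t with
  | var x => rfl
  | app n f ts ih => simp only [Term.subst, ih]

theorem Term.exists_of_mem_vars_subst {g : ℕ → Term F} {t : Term F} {y : ℕ}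
    (hy : y ∈ (t.subst g).vars) : ∃ x ∈ t.vars, y ∈ (g x).vars := by
  induction t with
  | var x => exact ⟨x, rfl, hy⟩
  | app n f ts ih =>
    obtain ⟨i, hi⟩ := Set.mem_iUnion.1 hy
    obtain ⟨x, hx, hxy⟩ := ih i hi
    exact ⟨x, Set.mem_iUnion.2 ⟨i, hx⟩, hxy⟩

theorem EqE.subst {E : Set (Term F × Term F)} {s t : Term F} (h : EqE E s t)
    (g : ℕ → Term F) : EqE E (s.subst g) (t.subst g) := by
  induction h with
  | ax σ hst =>
    rw [Term.subst_subst, Term.subst_subst]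
    exact .ax _ hst
  | refl t => exact .refl _
  | symm _ ih => exact ih.symm
  | trans _ _ ih₁ ih₂ => exact ih₁.trans ih₂
  | congr f _ ih => exact .congr f ih

theorem finite_varsP {Γ : Set (Term F × Term F)} (hΓ : Γ.Finite) : (VarsP Γ).Finite :=
  hΓ.biUnion fun p _ => p.1.finite_vars.union p.2.finite_vars

open Classical in
/-- The substitution that follows `g` on the finite set `W` and fixes all other variables. -/
noncomputable def Subst.ofFinite (g : ℕ → Term F) {W : Set ℕ} (hW : W.Finite) : Subst F where
  toFun x := if x ∈ W then g x else .var x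
  finite_dom := hW.subset fun x hx => by
    by_contra h
    exact hx (if_neg h)

theorem Subst.ofFinite_of_mem (g : ℕ → Term F) {W : Set ℕ} (hW : W.Finite) {x : ℕ}
    (hx : x ∈ W) : (Subst.ofFinite g hW).toFun x = g x :=
  if_pos hx

theorem Subst.ofFinite_of_notMem (g : ℕ → Term F) {W : Set ℕ} (hW : W.Finite) {x : ℕ}
    (hx : x ∉ W) : (Subst.ofFinite g hW).toFun x = .var x :=
  if_neg hx

/-- The substitution applying `σ` first and then `τ`. -/
def Subst.comp (σ τ : Subst F) : Subst F where
  toFun x := (σ.toFun x).subst τ.toFun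
  finite_dom := (σ.finite_dom.union τ.finite_dom).subset fun x hx => by
    by_contra h
    simp only [Set.mem_union, Set.mem_ofPred_eq, not_or, not_not] at h
    exact hx (by rw [h.1]; exact h.2)

open Classical in
/-- The substitution that follows `θ` on `X` and `τ` outside `X`. -/
noncomputable def Subst.piecewise (X : Set ℕ) (θ τ : Subst F) : Subst F where
  toFun x := if x ∈ X then θ.toFun x else τ.toFun x
  finite_dom := (θ.finite_dom.union τ.finite_dom).subset fun x hx => by
    by_cases h : x ∈ X
    · exact .inl (by simpa [h] using hx)
    · exact .inr (by simpa [h] using hx)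

theorem Subst.piecewise_of_mem {X : Set ℕ} (θ τ : Subst F) {x : ℕ} (hx : x ∈ X) :
    (Subst.piecewise X θ τ).toFun x = θ.toFun x :=
  if_pos hx

theorem Subst.piecewise_of_notMem {X : Set ℕ} (θ τ : Subst F) {x : ℕ} (hx : x ∉ X) :
    (Subst.piecewise X θ τ).toFun x = τ.toFun x :=
  if_neg hx

theorem InstLE.mono {E : Set (Term F × Term F)} {X Y : Set ℕ} {σ θ : Subst F}
    (h : InstLE E X σ θ) (hYX : Y ⊆ X) : InstLE E Y σ θ :=
  h.imp fun _ H x hx => H x (hYX hx)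

theorem InstLE.trans {E : Set (Term F × Term F)} {X : Set ℕ} {σ τ θ : Subst F}
    (h₁ : InstLE E X σ τ) (h₂ : InstLE E X τ θ) : InstLE E X σ θ := by
  obtain ⟨l, hl⟩ := h₁
  obtain ⟨m, hm⟩ := h₂
  refine ⟨l.comp m, fun x hx => ?_⟩
  have h := ((hl x hx).subst m.toFun).trans (hm x hx)
  rwa [Term.subst_subst] at h

theorem Unifier.of_eq_subst {E Γ : Set (Term F × Term F)} {σ τ : Subst F}
    (hσ : Unifier E Γ σ) (g : ℕ → Term F)
    (h : ∀ x ∈ VarsP Γ, τ.toFun x = (σ.toFun x).subst g) : Unifier E Γ τ := by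
  intro p hp
  have key : ∀ t : Term F, t.vars ⊆ VarsP Γ →
      t.subst τ.toFun = (t.subst σ.toFun).subst g := fun t ht => by
    rw [Term.subst_subst]
    exact Term.subst_congr fun x hx => h x (ht hx)
  rw [key p.1 fun x hx => Set.mem_biUnion hp (.inl hx),
    key p.2 fun x hx => Set.mem_biUnion hp (.inr hx)]
  exact (hσ p hp).subst g

/-- A substitution that is the identity on `X \ Y` and maps `Y` to terms without variables
from `X` is more general on all of `X` as soon as it is so on `Y`. -/
theorem InstLE.extend {E : Set (Term F × Term F)} {X Y : Set ℕ} {σ θ : Subst F}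
    (h : InstLE E Y σ θ) (hY : ∀ x ∈ Y, Disjoint (σ.toFun x).vars X)
    (hid : ∀ x ∉ Y, σ.toFun x = .var x) : InstLE E X σ θ := by
  obtain ⟨l, hl⟩ := h
  refine ⟨Subst.piecewise X θ l, fun x hx => ?_⟩
  by_cases hxY : x ∈ Y
  · rw [Term.subst_congr fun y hy =>
      Subst.piecewise_of_notMem θ l (Set.disjoint_left.1 (hY x hxY) hy)]
    exact hl x hxY
  · rw [hid x hxY]
    simp only [Term.subst, Subst.piecewise_of_mem θ l hx]
    exact .refl _

/-- Every substitution can be renamed on a finite set `Y` so as to avoid the variables in `X`,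
and made the identity outside `Y`. -/
theorem Subst.exists_fresh_variant {X Y : Set ℕ} (hY : Y.Finite) (hX : Xᶜ.Infinite)
    (σ : Subst F) :
    ∃ σ' : Subst F,
      (∃ ρ : Subst F, ∀ x ∈ Y, σ'.toFun x = (σ.toFun x).subst ρ.toFun) ∧
      (∃ ρ : Subst F, ∀ x ∈ Y, (σ'.toFun x).subst ρ.toFun = σ.toFun x) ∧
      (∀ x ∈ Y, Disjoint (σ'.toFun x).vars X) ∧ ∀ x ∉ Y, σ'.toFun x = .var x := by
  obtain ⟨f, hf⟩ : ∃ f : ℕ ↪ ℕ, ∀ n, f n ∉ X :=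
    ⟨(hX.natEmbedding _).trans (Function.Embedding.subtype _), fun n => (hX.natEmbedding _ n).2⟩
  have hW : (⋃ x ∈ Y, (σ.toFun x).vars).Finite := hY.biUnion fun x _ => Term.finite_vars _
  have hmem : ∀ x ∈ Y, ∀ y ∈ (σ.toFun x).vars, y ∈ ⋃ x ∈ Y, (σ.toFun x).vars :=
    fun x hx y hy => Set.mem_biUnion hx hy
  refine ⟨.ofFinite (fun x => (σ.toFun x).subst fun y => .var (f y)) hY,
    ⟨.ofFinite (fun y => .var (f y)) hW, fun x hx => ?_⟩,
    ⟨.ofFinite (fun y => .var (Function.invFun f y)) (hW.image f), fun x hx => ?_⟩,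
    fun x hx => ?_, fun x hx => Subst.ofFinite_of_notMem _ _ hx⟩
  · rw [Subst.ofFinite_of_mem _ _ hx]
    exact Term.subst_congr fun y hy =>
      (Subst.ofFinite_of_mem (fun y => .var (f y)) hW (hmem x hx y hy)).symm
  · rw [Subst.ofFinite_of_mem _ _ hx, Term.subst_subst]
    conv_rhs => rw [← Term.subst_var (σ.toFun x)]
    refine Term.subst_congr fun y hy => ?_
    simp only [Term.subst]
    rw [Subst.ofFinite_of_mem _ _ (Set.mem_image_of_mem f (hmem x hx y hy)),
      Function.leftInverse_invFun f.injective y]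
  · rw [Subst.ofFinite_of_mem _ _ hx, Set.disjoint_left]
    intro y hy
    obtain ⟨z, -, hz⟩ := Term.exists_of_mem_vars_subst hy
    rw [Set.mem_singleton_iff.1 hz]
    exact hf z

theorem Unifier.exists_fresh_variant {E Γ : Set (Term F × Term F)} {X : Set ℕ}
    (hΓ : Γ.Finite) (hX : Xᶜ.Infinite) {σ : Subst F} (hσ : Unifier E Γ σ) :
    ∃ σ' : Subst F, Unifier E Γ σ' ∧ InstEquiv E (VarsP Γ) σ σ' ∧
      ∀ θ, InstLE E (VarsP Γ) σ' θ → InstLE E X σ' θ := by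
  obtain ⟨σ', ⟨ρ, hρ⟩, ⟨ρ', hρ'⟩, hd, hid⟩ :=
    Subst.exists_fresh_variant (finite_varsP hΓ) hX σ
  refine ⟨σ', hσ.of_eq_subst ρ.toFun hρ, ⟨⟨ρ, fun x hx => ?_⟩, ⟨ρ', fun x hx => ?_⟩⟩,
    fun θ h => h.extend hd hid⟩
  · rw [hρ x hx]
    exact .refl _
  · rw [hρ' x hx]
    exact .refl _

/-- Proposition `types:same:lem`: for a non-trivial theory `E`,
a unification problem `Γ`, `X₀ := Var(Γ)` and a set of variables `X` with
`X₀ ⊆ X` such that `V \ X` is infinite: `Γ` has a minimal complete set of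
`E`-unifiers w.r.t. `≤_E^X` iff it has one w.r.t. `≤_E^{X₀}` of the same
cardinality (in both directions). -/
theorem stmt0 {F : ℕ → Type} (E : Set (Term F × Term F)) (hE : NonTrivial E)
    (Γ : Set (Term F × Term F)) (hΓ : Γ.Finite) (X : Set ℕ)
    (hX0 : VarsP Γ ⊆ X) (hinf : Xᶜ.Infinite) :
    (∀ S : Set (Subst F), MinimalComplete E Γ X S →
      ∃ S' : Set (Subst F), MinimalComplete E Γ (VarsP Γ) S' ∧
        Cardinal.mk S' = Cardinal.mk S) ∧
    (∀ S : Set (Subst F), MinimalComplete E Γ (VarsP Γ) S →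
      ∃ S' : Set (Subst F), MinimalComplete E Γ X S' ∧
        Cardinal.mk S' = Cardinal.mk S) := by
  constructor
  · rintro S ⟨⟨hU, hC⟩, hM⟩
    refine ⟨S, ⟨⟨hU, fun θ hθ => ?_⟩, fun σ hσ τ hτ hne hle => ?_⟩, rfl⟩
    · obtain ⟨σ, hσ, h⟩ := hC θ hθ
      exact ⟨σ, hσ, h.mono hX0⟩
    · obtain ⟨σ', hU', ⟨-, h₂⟩, hext⟩ := (hU σ hσ).exists_fresh_variant hΓ hinf
      obtain ⟨ρ, hρ, hρσ'⟩ := hC σ' hU'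
      have hρσ : ρ = σ := by
        by_contra h
        exact hM ρ hρ σ hσ h (hρσ'.trans (hext σ h₂))
      subst hρσ
      exact hM ρ hρ τ hτ hne (hρσ'.trans (hext τ (h₂.trans hle)))
  · rintro S ⟨⟨hU, hC⟩, hM⟩
    choose g hgU hgE hgX using fun σ : S => (hU σ σ.2).exists_fresh_variant hΓ hinf
    have hg : ∀ σ τ : S, InstLE E (VarsP Γ) (g σ) (g τ) → σ = τ := fun σ τ h => by
      by_contra hne
      exact hM σ σ.2 τ τ.2 (fun h' => hne (Subtype.ext h'))
        (((hgE σ).1.trans h).trans (hgE τ).2)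
    have hinj : Function.Injective g := fun σ τ h =>
      hg σ τ ((hgE σ).2.trans (h ▸ (hgE σ).1))
    refine ⟨Set.range g, ⟨⟨?_, fun θ hθ => ?_⟩, ?_⟩, Cardinal.mk_range_eq g hinj⟩
    · rintro _ ⟨σ, rfl⟩
      exact hgU σ
    · obtain ⟨σ, hσ, h⟩ := hC θ hθ
      exact ⟨_, ⟨⟨σ, hσ⟩, rfl⟩, hgX _ θ ((hgE ⟨σ, hσ⟩).2.trans h)⟩
    · rintro _ ⟨σ, rfl⟩ _ ⟨τ, rfl⟩ hne h
      exact hne (congrArg g (hg σ τ (h.mono hX0)))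
end UnifFW
end

section
/- The equational theories ∅ (the empty theory), C, A, AC, and D are finite, i.e., for each of these theories E and every term t over the respective signature, the set {s | s ≈_E t} is finite. In particular, for the theory D of two-sided distributivity, every ≈_D-equivalence class of terms over the signature {m, p} is finite. -/
namespace UnifFW

variable {F : ℕ → Type}

/-- `E` is a finite theory: every `≈_E`-equivalence class of terms is finite. -/
def FiniteTheory {F : ℕ → Type} (E : Set (Term F × Term F)) : Prop :=
  ∀ t : Term F, {s : Term F | EqE E s t}.Finite

/-- Signature with a single binary function symbol `f`. -/
inductive SigF : ℕ → Type
  | f : SigF 2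

/-- Signature with two binary function symbols `m` and `p`. -/
inductive SigD : ℕ → Type
  | m : SigD 2
  | p : SigD 2

/-- The term `f(s,t)`. -/
def fT (s t : Term SigF) : Term SigF := Term.app 2 SigF.f ![s, t]

/-- The term `m(s,t)`. -/
def mT (s t : Term SigD) : Term SigD := Term.app 2 SigD.m ![s, t]

/-- The term `p(s,t)`. -/
def pT (s t : Term SigD) : Term SigD := Term.app 2 SigD.p ![s, t]

/-- Associativity: `f(x, f(y, z)) ≈ f(f(x, y), z)`. -/
def ATheory : Set (Term SigF × Term SigF) :=
  {(fT (.var 0) (fT (.var 1) (.var 2)), fT (fT (.var 0) (.var 1)) (.var 2))}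

/-- Commutativity: `f(x, y) ≈ f(y, x)`. -/
def CTheory : Set (Term SigF × Term SigF) :=
  {(fT (.var 0) (.var 1), fT (.var 1) (.var 0))}

/-- The theory `AC`. -/
def ACTheory : Set (Term SigF × Term SigF) := ATheory ∪ CTheory

/-- Two-sided distributivity of `m` over `p`. -/
def DTheory : Set (Term SigD × Term SigD) :=
  {(mT (.var 2) (pT (.var 0) (.var 1)), pT (mT (.var 2) (.var 0)) (mT (.var 2) (.var 1))),
   (mT (pT (.var 0) (.var 1)) (.var 2), pT (mT (.var 0) (.var 2)) (mT (.var 1) (.var 2)))}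

/-- The value of a term in the algebra on `ℕ` with operations `op` under the valuation `v`. -/
def Term.evalAt (op : ∀ n, F n → (Fin n → ℕ) → ℕ) (v : ℕ → ℕ) : Term F → ℕ
  | .var x => v x
  | .app n f ts => op n f fun i => (ts i).evalAt op v

/-- The value of a term in the algebra on `ℕ` with operations `op`, where the variable with
index `x` takes the value `x + 2`. -/
def Term.eval (op : ∀ n, F n → (Fin n → ℕ) → ℕ) (t : Term F) : ℕ :=
  t.evalAt op (· + 2)

theorem Term.eval_subst (op : ∀ n, F n → (Fin n → ℕ) → ℕ) (σ : ℕ → Term F) (t : Term F) :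
    (t.subst σ).eval op = t.evalAt op fun x => (σ x).eval op := by
  induction t with
  | var x => rfl
  | app n f ts ih => simp_all only [subst, eval, evalAt]

/-- An algebra satisfying the identities of `E` identifies `E`-equal terms. -/
theorem EqE.eval_eq {E : Set (Term F × Term F)} {op : ∀ n, F n → (Fin n → ℕ) → ℕ}
    (hE : ∀ e ∈ E, ∀ v, e.1.evalAt op v = e.2.evalAt op v) {s t : Term F} (h : EqE E s t) :
    s.eval op = t.eval op := by
  induction h with
  | ax σ h => rw [Term.eval_subst, Term.eval_subst]; exact hE _ h _
  | refl => rfl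
  | symm _ ih => exact ih.symm
  | trans _ _ ih₁ ih₂ => exact ih₁.trans ih₂
  | congr f _ ih => exact congrArg (op _ f) (funext ih)

/-- Operations preserve the numbers `≥ 2`, and on these are strictly larger than each
argument. -/
def Increasing (op : ∀ n, F n → (Fin n → ℕ) → ℕ) : Prop :=
  ∀ n f a, (∀ i, 2 ≤ a i) → 2 ≤ op n f a ∧ ∀ i, a i < op n f a

theorem Increasing.two_le_eval {op : ∀ n, F n → (Fin n → ℕ) → ℕ} (hop : Increasing op)
    (t : Term F) : 2 ≤ t.eval op := by
  induction t with
  | var x => exact Nat.le_add_left 2 x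
  | app n f ts ih => exact (hop n f _ ih).1

theorem Increasing.finite_eval_le [Finite (Σ n, F n)] {op : ∀ n, F n → (Fin n → ℕ) → ℕ}
    (hop : Increasing op) (k : ℕ) : {t : Term F | t.eval op ≤ k}.Finite := by
  induction k with
  | zero =>
    refine Set.finite_empty.subset fun t ht => ?_
    have := hop.two_le_eval t
    simp only [Set.mem_ofPred_eq] at ht
    omega
  | succ k ih =>
    have happ : (⋃ g : Σ n, F n,
        Term.app g.1 g.2 '' {ts | ∀ i, ts i ∈ {t : Term F | t.eval op ≤ k}}).Finite :=
      Set.finite_iUnion fun g => (Set.Finite.pi' fun _ => ih).image _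
    refine (((Set.finite_Iic k).image Term.var).union happ).subset fun t ht => ?_
    cases t with
    | var x =>
      refine Or.inl ⟨x, ?_, rfl⟩
      simp only [Set.mem_ofPred_eq, Term.eval, Term.evalAt] at ht
      simp only [Set.mem_Iic]
      omega
    | app n f ts =>
      refine Or.inr (Set.mem_iUnion.2 ⟨⟨n, f⟩, ts, fun i => ?_, rfl⟩)
      exact Nat.le_of_lt_succ
        (((hop n f _ fun i => hop.two_le_eval (ts i)).2 i).trans_le ht)

/-- A theory over a finite signature with an increasing model on `ℕ` is finite. -/
theorem Increasing.finiteTheory [Finite (Σ n, F n)] {op : ∀ n, F n → (Fin n → ℕ) → ℕ}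
    (hop : Increasing op) {E : Set (Term F × Term F)}
    (hE : ∀ e ∈ E, ∀ v, e.1.evalAt op v = e.2.evalAt op v) : FiniteTheory E := fun t =>
  (hop.finite_eval_le (t.eval op)).subset fun _ hs => (EqE.eval_eq hE hs).le

theorem eq_of_eqE_empty {s t : Term F} (h : EqE ∅ s t) : s = t := by
  induction h with
  | ax _ h => exact h.elim
  | refl => rfl
  | symm _ ih => exact ih.symm
  | trans _ _ ih₁ ih₂ => exact ih₁.trans ih₂
  | congr f _ ih => exact congrArg _ (funext ih)

theorem finiteTheory_empty : FiniteTheory (∅ : Set (Term F × Term F)) := fun t =>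
  (Set.finite_singleton t).subset fun _ hs => eq_of_eqE_empty hs

instance : Finite (Σ n, SigF n) :=
  Finite.of_surjective (fun _ : Unit => (⟨2, .f⟩ : Σ n, SigF n)) fun ⟨_, .f⟩ => ⟨(), rfl⟩

instance : Finite (Σ n, SigD n) :=
  Finite.of_surjective (fun b : Bool => (⟨2, bif b then .m else .p⟩ : Σ n, SigD n)) fun
    | ⟨_, .m⟩ => ⟨true, rfl⟩
    | ⟨_, .p⟩ => ⟨false, rfl⟩

/-- Interpretation of `f` as addition. -/
def opF : ∀ n, SigF n → (Fin n → ℕ) → ℕ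
  | _, .f, a => a 0 + a 1

/-- Interpretation of `m` as multiplication and of `p` as addition. -/
def opD : ∀ n, SigD n → (Fin n → ℕ) → ℕ
  | _, .m, a => a 0 * a 1
  | _, .p, a => a 0 + a 1

theorem increasing_opF : Increasing opF := by
  rintro _ ⟨⟩ a ha
  have h₀ := ha 0
  have h₁ := ha 1
  simp only [opF, Fin.forall_fin_two]
  omega

theorem increasing_opD : Increasing opD := by
  rintro _ (_ | _) a ha
  all_goals
    have h₀ := ha 0
    have h₁ := ha 1
    simp only [opD, Fin.forall_fin_two]
  · refine ⟨?_, ?_, ?_⟩ <;> nlinarith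
  · omega

theorem evalAt_ATheory : ∀ e ∈ ATheory, ∀ v, e.1.evalAt opF v = e.2.evalAt opF v := by
  rintro _ rfl v
  simp [fT, Term.evalAt, opF, add_assoc]

theorem evalAt_CTheory : ∀ e ∈ CTheory, ∀ v, e.1.evalAt opF v = e.2.evalAt opF v := by
  rintro _ rfl v
  simp [fT, Term.evalAt, opF, add_comm]

theorem evalAt_DTheory : ∀ e ∈ DTheory, ∀ v, e.1.evalAt opD v = e.2.evalAt opD v := by
  rintro _ (rfl | rfl) v
  · simp [mT, pT, Term.evalAt, opD, mul_add]
  · simp [mT, pT, Term.evalAt, opD, add_mul]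

/-- Proposition `finite:theories:prop`: the empty theory,
`C`, `A`, `AC`, and `D` are finite theories. -/
theorem stmt13 :
    (∀ F : ℕ → Type, FiniteTheory (∅ : Set (Term F × Term F))) ∧
    FiniteTheory CTheory ∧ FiniteTheory ATheory ∧ FiniteTheory ACTheory ∧
    FiniteTheory DTheory := by
  exact ⟨fun _ => finiteTheory_empty, increasing_opF.finiteTheory evalAt_CTheory,
    increasing_opF.finiteTheory evalAt_ATheory,
    increasing_opF.finiteTheory fun e he => he.elim (evalAt_ATheory e) (evalAt_CTheory e),
    increasing_opD.finiteTheory evalAt_DTheory⟩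
end UnifFW
end
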